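/- arXiv:0808.3544 — 7 statements merged into one kernel-verified Lean document; each statement's English description precedes it below -/
import Mathlib

section
/- Let p be an odd prime and let i ≥ 0 and m ≥ 0 be integers, and set n = (m+i)p − i = i(p−1) + mp, assumed positive. Let u be a partition with w(u) = n and d(u) ≤ i+1. Then there exists a partition u′ that is reduced with respect to p such that w(u′) = n, d(u′) ≤ i+1 and v_p(τ_u) ≥ v_p(τ_{u′}). -/
open Finsupp MvPolynomial

noncomputable section

/-- weight of a partition (given as the multiplicity function of its parts) -/
def wt (u : ℕ →₀ ℕ) : ℕ := u.sum fun i m => i * m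

/-- degree (number of parts) -/
def deg (u : ℕ →₀ ℕ) : ℕ := u.sum fun _ m => m

/-- γ_u = Π_i (i+1)^{u_i} (u_i)! -/
def gam (u : ℕ →₀ ℕ) : ℕ := u.prod fun i m => (i + 1) ^ m * m.factorial

/-- τ_u = (−1)^{d(u)−1} (w(u)+d(u)−2)! / γ_u -/
def tau (u : ℕ →₀ ℕ) : ℚ :=
  (-1 : ℚ) ^ (deg u - 1) * (Nat.factorial (wt u + deg u - 2) : ℚ) / (gam u : ℚ)

/-- p-adic valuation on ℚ with v_p(0) = ⊤ -/
def pval (p : ℕ) (x : ℚ) : WithTop ℤ :=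
  if x = 0 then ⊤ else ((padicValRat p x : ℤ) : WithTop ℤ)

/-- u is reduced with respect to p: there is at most one part g not of the form
p^α − 1 (α ≥ 1), that part has multiplicity 1, and all other parts with nonzero
multiplicity are of the form p^α − 1. -/
def ReducedPart (p : ℕ) (u : ℕ →₀ ℕ) : Prop :=
  ∀ g, u g ≠ 0 → (¬ ∃ α ≥ 1, g = p ^ α - 1) →
    u g = 1 ∧ ∀ g', u g' ≠ 0 → (¬ ∃ α ≥ 1, g' = p ^ α - 1) → g' = g

lemma wt_add (u v : ℕ →₀ ℕ) : wt (u + v) = wt u + wt v :=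
  Finsupp.sum_add_index' (fun _ => by simp) fun _ _ _ => by ring

lemma deg_add (u v : ℕ →₀ ℕ) : deg (u + v) = deg u + deg v :=
  Finsupp.sum_add_index' (fun _ => rfl) fun _ _ _ => rfl

@[simp] lemma wt_single (a r : ℕ) : wt (single a r) = a * r := by simp [wt]

@[simp] lemma deg_single (a r : ℕ) : deg (single a r) = r := by simp [deg]

lemma gam_ne_zero (u : ℕ →₀ ℕ) : gam u ≠ 0 := by
  unfold gam Finsupp.prod
  exact Finset.prod_ne_zero_iff.2 fun i _ => by positivity

/-- The contribution of `m` parts equal to `i` to the valuation of `γ`; parts `0` contribute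
nothing. -/
def partVal (p i m : ℕ) : ℕ :=
  if i = 0 then 0 else m * padicValNat p (i + 1) + padicValNat p m.factorial

/-- The `p`-adic valuation of `γ_u`, ignoring parts equal to `0`. -/
def gamVal (p : ℕ) (u : ℕ →₀ ℕ) : ℕ := u.sum (partVal p)

@[simp] lemma partVal_zero_right (p i : ℕ) : partVal p i 0 = 0 := by simp [partVal]

@[simp] lemma gamVal_single (p a r : ℕ) : gamVal p (single a r) = partVal p a r := by
  simp [gamVal]

lemma le_partVal (p i m : ℕ) : m * padicValNat p (i + 1) ≤ partVal p i m := by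
  unfold partVal
  split_ifs with h <;> simp [h]

lemma partVal_add_le (p i a b : ℕ) [Fact p.Prime] :
    partVal p i a + partVal p i b ≤ partVal p i (a + b) := by
  unfold partVal
  split_ifs
  · simp
  · have h : padicValNat p (a.factorial * b.factorial) ≤ padicValNat p (a + b).factorial :=
      (padicValNat_dvd_iff_le (Nat.factorial_ne_zero _)).1
        (pow_padicValNat_dvd.trans (Nat.factorial_mul_factorial_dvd_factorial_add a b))
    rw [padicValNat.mul (Nat.factorial_ne_zero _) (Nat.factorial_ne_zero _)] at h
    linarith [add_mul a b (padicValNat p (i + 1))]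

lemma gamVal_add_le (p : ℕ) [Fact p.Prime] (u v : ℕ →₀ ℕ) :
    gamVal p u + gamVal p v ≤ gamVal p (u + v) := by
  classical
  have key : ∀ w : ℕ →₀ ℕ, w.support ⊆ u.support ∪ v.support →
      gamVal p w = ∑ i ∈ u.support ∪ v.support, partVal p i (w i) := fun w hw =>
    Finsupp.sum_of_support_subset _ hw _ fun _ _ => partVal_zero_right _ _
  rw [key u Finset.subset_union_left, key v Finset.subset_union_right,
    key (u + v) Finsupp.support_add, ← Finset.sum_add_distrib]
  exact Finset.sum_le_sum fun i _ => partVal_add_le p i _ _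

lemma gamVal_eq_erase (p : ℕ) (u : ℕ →₀ ℕ) (a : ℕ) :
    gamVal p u = partVal p a (u a) + gamVal p (u.erase a) :=
  (Finsupp.add_sum_erase' u a (partVal p) fun _ => partVal_zero_right _ _).symm

lemma padicValNat_gam (p : ℕ) [Fact p.Prime] (u : ℕ →₀ ℕ) (hu : u 0 = 0) :
    padicValNat p (gam u) = gamVal p u := by
  have key : ∀ s : Finset ℕ, 0 ∉ s →
      padicValNat p (∏ i ∈ s, (i + 1) ^ u i * (u i).factorial) = ∑ i ∈ s, partVal p i (u i) := by
    intro s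
    induction s using Finset.induction_on with
    | empty => simp
    | insert a s ha ih =>
      intro h0
      rw [Finset.mem_insert, not_or] at h0
      rw [Finset.prod_insert ha, Finset.sum_insert ha, padicValNat.mul (by positivity)
        (Finset.prod_ne_zero_iff.2 fun i _ => by positivity), ih h0.2,
        padicValNat.mul (by positivity) (by positivity), padicValNat.pow,
        partVal, if_neg (Ne.symm h0.1)]
  exact key u.support (by simp [hu])

lemma pval_tau (p : ℕ) [Fact p.Prime] (u : ℕ →₀ ℕ) (hu : u 0 = 0) :
    pval p (tau u) =
      (((padicValNat p (wt u + deg u - 2).factorial : ℤ) - gamVal p u : ℤ) : WithTop ℤ) := by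
  have h1 : (Nat.factorial (wt u + deg u - 2) : ℚ) ≠ 0 := by positivity
  have h2 : (gam u : ℚ) ≠ 0 := by exact_mod_cast gam_ne_zero u
  have h3 : (-1 : ℚ) ^ (deg u - 1) ≠ 0 := by simp
  have h4 : tau u ≠ 0 := div_ne_zero (mul_ne_zero h3 h1) h2
  rw [pval, if_neg h4, tau, padicValRat.div (mul_ne_zero h3 h1) h2, padicValRat.mul h3 h1,
    padicValRat.pow, padicValRat.of_nat, padicValRat.of_nat, padicValNat_gam p u hu]
  simp

/-- `i` is of the form `p ^ α - 1` with `α ≥ 0`. -/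
def IsSpecial (p i : ℕ) : Prop := ∃ α, i = p ^ α - 1

open Classical in
/-- The number of parts of `u` that are not of the form `p ^ α - 1`. -/
def nonspecialCount (p : ℕ) (u : ℕ →₀ ℕ) : ℕ := u.sum fun i m => if IsSpecial p i then 0 else m

lemma nonspecialCount_add (p : ℕ) (u v : ℕ →₀ ℕ) :
    nonspecialCount p (u + v) = nonspecialCount p u + nonspecialCount p v :=
  Finsupp.sum_add_index' (fun _ => by simp) fun _ _ _ => by split_ifs <;> rfl

lemma nonspecialCount_single_of_isSpecial {p a : ℕ} (r : ℕ) (h : IsSpecial p a) :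
    nonspecialCount p (single a r) = 0 := by simp [nonspecialCount, h]

lemma nonspecialCount_single_of_not_isSpecial {p a : ℕ} (r : ℕ) (h : ¬ IsSpecial p a) :
    nonspecialCount p (single a r) = r := by simp [nonspecialCount, h]

lemma nonspecialCount_single_le (p a r : ℕ) : nonspecialCount p (single a r) ≤ r := by
  by_cases h : IsSpecial p a
  · simp [nonspecialCount_single_of_isSpecial r h]
  · simp [nonspecialCount_single_of_not_isSpecial r h]

lemma exists_add_one_eq_pow_mul (p a : ℕ) [Fact p.Prime] :
    ∃ c, 1 ≤ c ∧ a + 1 = p ^ padicValNat p (a + 1) * c := by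
  obtain ⟨c, hc⟩ := pow_padicValNat_dvd (p := p) (n := a + 1)
  refine ⟨c, Nat.pos_of_ne_zero ?_, hc⟩
  rintro rfl
  simp at hc

lemma padicValNat_factorial_eq_div (p r : ℕ) [Fact p.Prime] :
    padicValNat p r.factorial = r / p + padicValNat p (r / p).factorial := by
  rw [← padicValNat_mul_div_factorial, padicValNat_factorial_mul, add_comm]

/-- Several copies of one nonspecial part can be traded for special parts and one other part. -/
lemma exists_replace_single (p a r : ℕ) [hp : Fact p.Prime] (ha : ¬ IsSpecial p a) (hr : 2 ≤ r) :
    ∃ w, wt w = a * r ∧ deg w = r ∧ partVal p a r ≤ gamVal p w ∧ nonspecialCount p w ≤ 1 := by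
  obtain ⟨c, hc1, hc⟩ := exists_add_one_eq_pow_mul p a
  set k := padicValNat p (a + 1) with hk
  have hp2 := hp.out.two_le
  have hP : 1 ≤ p ^ k := Nat.one_le_pow _ _ (by omega)
  have hP' : 1 ≤ p ^ (k + 1) := Nat.one_le_pow _ _ (by omega)
  have hc2 : 2 ≤ c := by
    by_contra h
    obtain rfl : c = 1 := by omega
    exact ha ⟨k, by omega⟩
  have hf := padicValNat_factorial_eq_div p r
  set s := r / p with hs
  have hsp : s * p ≤ r := Nat.div_mul_le_self r p
  have hs2 : s * 2 ≤ s * p := Nat.mul_le_mul_left _ hp2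
  obtain ⟨t, ht⟩ : ∃ t, r = t + s + 1 := ⟨r - s - 1, by omega⟩
  have hrc : r * 2 ≤ r * c := Nat.mul_le_mul_left _ hc2
  obtain ⟨q, hq⟩ : ∃ q, q + s * p + r = r * c + s + 1 := ⟨r * c + s + 1 - s * p - r, by omega⟩
  have hq1 : 1 ≤ q := by omega
  have hz1 : 1 ≤ p ^ k * q := Nat.mul_pos hP hq1
  obtain ⟨x, hx⟩ : ∃ x, x + 1 = p ^ (k + 1) := ⟨p ^ (k + 1) - 1, by omega⟩
  obtain ⟨y, hy⟩ : ∃ y, y + 1 = p ^ k := ⟨p ^ k - 1, by omega⟩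
  obtain ⟨z, hz⟩ : ∃ z, z + 1 = p ^ k * q := ⟨p ^ k * q - 1, by omega⟩
  refine ⟨single x s + single y t + single z 1, ?_, ?_, ?_, ?_⟩
  · simp only [wt_add, wt_single]
    rw [pow_succ] at hx
    zify at *
    linear_combination s * hx + t * hy + hz - r * hc + p ^ k * hq - (p ^ k - 1) * ht
  · simp only [deg_add, deg_single]
    omega
  · have h1 := gamVal_add_le p (single x s + single y t) (single z 1)
    have h2 := gamVal_add_le p (single x s) (single y t)
    simp only [gamVal_single] at h1 h2
    have hx0 : x ≠ 0 := by
      have : 1 < p ^ (k + 1) := Nat.one_lt_pow (Nat.succ_ne_zero k) (by omega)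
      omega
    have h3 : partVal p x s = s * (k + 1) + padicValNat p s.factorial := by
      rw [partVal, if_neg hx0, hx, padicValNat.prime_pow]
    have h4 := le_partVal p y t
    rw [hy, padicValNat.prime_pow] at h4
    have h5 := le_partVal p z 1
    have h6 : k ≤ padicValNat p (z + 1) :=
      (padicValNat_dvd_iff_le z.add_one_ne_zero).1 ⟨q, hz⟩
    have h7 : partVal p a r ≤ r * k + padicValNat p r.factorial := by
      unfold partVal
      split_ifs <;> simp [hk]
    have h8 : r * k = t * k + s * k + k := by rw [ht]; ring
    linarith [mul_add s k 1]
  · rw [nonspecialCount_add, nonspecialCount_add,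
      nonspecialCount_single_of_isSpecial s ⟨k + 1, by omega⟩,
      nonspecialCount_single_of_isSpecial t ⟨k, by omega⟩]
    simpa using nonspecialCount_single_le p z 1

/-- Two parts can be traded for a special part and one other part. -/
lemma exists_replace_pair (p a b : ℕ) [hp : Fact p.Prime] :
    ∃ w, wt w = a + b ∧ deg w = 2 ∧ partVal p a 1 + partVal p b 1 ≤ gamVal p w ∧
      nonspecialCount p w ≤ 1 := by
  wlog hab : padicValNat p (b + 1) ≤ padicValNat p (a + 1) generalizing a b
  · obtain ⟨w, h1, h2, h3, h4⟩ := this b a (by omega)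
    exact ⟨w, by omega, h2, by omega, h4⟩
  obtain ⟨c, hc1, hc⟩ := exists_add_one_eq_pow_mul p a
  set k := padicValNat p (a + 1) with hk
  have hP : 1 ≤ p ^ k := Nat.one_le_pow _ _ hp.out.pos
  obtain ⟨y, hy⟩ : ∃ y, y + 1 = p ^ k := ⟨p ^ k - 1, by omega⟩
  obtain ⟨e, rfl⟩ : ∃ e, c = e + 1 := ⟨c - 1, by omega⟩
  rw [mul_add, mul_one] at hc
  have hval : ∀ i, partVal p i 1 ≤ padicValNat p (i + 1) := fun i => by
    unfold partVal
    split_ifs <;> simp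
  refine ⟨single y 1 + single (p ^ k * e + b) 1, ?_, ?_, ?_, ?_⟩
  · simp only [wt_add, wt_single]
    omega
  · simp [deg_add]
  · have h1 := gamVal_add_le p (single y 1) (single (p ^ k * e + b) 1)
    simp only [gamVal_single] at h1
    have h4 := le_partVal p y 1
    rw [hy, padicValNat.prime_pow] at h4
    have h5 := le_partVal p (p ^ k * e + b) 1
    have h6 : padicValNat p (b + 1) ≤ padicValNat p (p ^ k * e + b + 1) :=
      (padicValNat_dvd_iff_le (Nat.add_one_ne_zero _)).1 <| by
        rw [add_assoc]
        exact dvd_add ((pow_dvd_pow p hab).mul_right e) pow_padicValNat_dvd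
    have h7 := hval a
    have h8 := hval b
    omega
  · rw [nonspecialCount_add, nonspecialCount_single_of_isSpecial 1 ⟨k, by omega⟩]
    simpa using nonspecialCount_single_le p _ 1

lemma le_nonspecialCount {p a : ℕ} (u : ℕ →₀ ℕ) (ha : ¬ IsSpecial p a) :
    u a ≤ nonspecialCount p u := by
  rw [← Finsupp.single_add_erase a u, nonspecialCount_add,
    nonspecialCount_single_of_not_isSpecial _ ha]
  simp

lemma add_le_nonspecialCount {p a b : ℕ} (u : ℕ →₀ ℕ) (ha : ¬ IsSpecial p a)
    (hb : ¬ IsSpecial p b) (hab : b ≠ a) : u a + u b ≤ nonspecialCount p u := by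
  conv_rhs => rw [← Finsupp.single_add_erase a u, nonspecialCount_add,
    nonspecialCount_single_of_not_isSpecial _ ha]
  have := le_nonspecialCount (u.erase a) hb
  rw [Finsupp.erase_ne hab] at this
  omega

lemma exists_nonspecial {p : ℕ} (u : ℕ →₀ ℕ) (h : nonspecialCount p u ≠ 0) :
    ∃ a, ¬ IsSpecial p a ∧ u a ≠ 0 := by
  by_contra! hc
  refine h (Finset.sum_eq_zero fun i _ => ?_)
  by_cases hi : IsSpecial p i
  · simp [hi]
  · simp [hc i hi]

/-- A partition with at least two nonspecial parts can be improved to one with fewer of them. -/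
lemma exists_nonspecialCount_lt (p : ℕ) [Fact p.Prime] (u : ℕ →₀ ℕ)
    (hu : 2 ≤ nonspecialCount p u) :
    ∃ u', wt u' = wt u ∧ deg u' = deg u ∧ gamVal p u ≤ gamVal p u' ∧
      nonspecialCount p u' < nonspecialCount p u := by
  have step : ∀ a, ¬ IsSpecial p a → wt u = a * u a + wt (u.erase a) ∧
      deg u = u a + deg (u.erase a) ∧
      nonspecialCount p u = u a + nonspecialCount p (u.erase a) := fun a ha => by
    refine ⟨?_, ?_, ?_⟩ <;> conv_lhs => rw [← Finsupp.single_add_erase a u]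
    · rw [wt_add, wt_single]
    · rw [deg_add, deg_single]
    · rw [nonspecialCount_add, nonspecialCount_single_of_not_isSpecial _ ha]
  by_cases h : ∃ a, ¬ IsSpecial p a ∧ 2 ≤ u a
  · obtain ⟨a, ha, hua⟩ := h
    obtain ⟨hW, hD, hN⟩ := step a ha
    have hG := gamVal_eq_erase p u a
    obtain ⟨w, h1, h2, h3, h4⟩ := exists_replace_single p a (u a) ha hua
    refine ⟨w + u.erase a, ?_, ?_, ?_, ?_⟩
    · rw [wt_add]; omega
    · rw [deg_add]; omega
    · have := gamVal_add_le p w (u.erase a)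
      omega
    · rw [nonspecialCount_add]; omega
  · push Not at h
    obtain ⟨a, ha, hua⟩ := exists_nonspecial (p := p) u (by omega)
    obtain ⟨hW, hD, hN⟩ := step a ha
    have hG := gamVal_eq_erase p u a
    have hua1 : u a = 1 := by have := h a ha; omega
    obtain ⟨b, hb, hub⟩ := exists_nonspecial (p := p) (u.erase a) (by omega)
    have hba : b ≠ a := by rintro rfl; simp at hub
    have hub1 : u.erase a b = 1 := by
      rw [Finsupp.erase_ne hba] at hub ⊢
      have := h b hb
      omega
    have hdec := Finsupp.single_add_erase b (u.erase a)
    have hW' := congrArg wt hdec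
    have hD' := congrArg deg hdec
    have hN' := congrArg (nonspecialCount p) hdec
    have hG' := gamVal_eq_erase p (u.erase a) b
    simp only [wt_add, deg_add, nonspecialCount_add, wt_single, deg_single,
      nonspecialCount_single_of_not_isSpecial _ hb] at hW' hD' hN'
    rw [hub1] at hW' hD' hN' hG'
    rw [hua1] at hW hD hN hG
    obtain ⟨w, h1, h2, h3, h4⟩ := exists_replace_pair p a b
    refine ⟨w + (u.erase a).erase b, ?_, ?_, ?_, ?_⟩
    · rw [wt_add]; omega
    · rw [deg_add]; omega
    · have := gamVal_add_le p w ((u.erase a).erase b)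
      omega
    · rw [nonspecialCount_add]; omega

lemma exists_nonspecialCount_le_one (p : ℕ) [Fact p.Prime] (u : ℕ →₀ ℕ) :
    ∃ u', wt u' = wt u ∧ deg u' = deg u ∧ gamVal p u ≤ gamVal p u' ∧
      nonspecialCount p u' ≤ 1 := by
  induction hN : nonspecialCount p u using Nat.strong_induction_on generalizing u with
  | _ N ih =>
    by_cases h : N ≤ 1
    · exact ⟨u, rfl, rfl, le_rfl, by omega⟩
    · obtain ⟨v, h1, h2, h3, h4⟩ := exists_nonspecialCount_lt p u (by omega)
      obtain ⟨u', k1, k2, k3, k4⟩ := ih _ (hN ▸ h4) v rfl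
      exact ⟨u', k1.trans h1, k2.trans h2, h3.trans k3, k4⟩

lemma reducedPart_of_nonspecialCount_le_one {p : ℕ} {u : ℕ →₀ ℕ} (hu : u 0 = 0)
    (h : nonspecialCount p u ≤ 1) : ReducedPart p u := by
  have key : ∀ g, u g ≠ 0 → (¬ ∃ α ≥ 1, g = p ^ α - 1) → ¬ IsSpecial p g := by
    rintro g hg hα ⟨α, rfl⟩
    rcases Nat.eq_zero_or_pos α with rfl | hpos
    · simp [hu] at hg
    · exact hα ⟨α, hpos, rfl⟩
  intro g hg hα
  have hgs := key g hg hα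
  refine ⟨?_, fun g' hg' hα' => ?_⟩
  · have := le_nonspecialCount u hgs
    omega
  · by_contra hne
    have := add_le_nonspecialCount u hgs (key g' hg' hα') hne
    omega

/-- for an odd prime p, n = (m+i)p − i > 0, and any partition u of n
with d(u) ≤ i+1, there is a reduced partition u' of n with d(u') ≤ i+1 and
v_p(τ_u) ≥ v_p(τ_{u'}). -/
theorem stmt_0 (p : ℕ) (hp : p.Prime) (hodd : p ≠ 2) (i m : ℕ)
    (n : ℕ) (hn : n = (m + i) * p - i) (hpos : 0 < n)
    (u : ℕ →₀ ℕ) (hu0 : u 0 = 0) (hw : wt u = n) (hd : deg u ≤ i + 1) :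
    ∃ u' : ℕ →₀ ℕ, u' 0 = 0 ∧ ReducedPart p u' ∧ wt u' = n ∧ deg u' ≤ i + 1 ∧
      pval p (tau u') ≤ pval p (tau u) := by
  have : Fact p.Prime := ⟨hp⟩
  obtain ⟨v, hv1, hv2, hv3, hv4⟩ := exists_nonspecialCount_le_one p u
  have hW : wt v = wt (v.erase 0) := by
    conv_lhs => rw [← Finsupp.single_add_erase 0 v, wt_add, wt_single]
    simp
  have hD : deg (v.erase 0) ≤ deg v := by
    conv_rhs => rw [← Finsupp.single_add_erase 0 v, deg_add]
    omega
  have hN : nonspecialCount p (v.erase 0) ≤ nonspecialCount p v := by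
    conv_rhs => rw [← Finsupp.single_add_erase 0 v, nonspecialCount_add]
    omega
  have hG : gamVal p v = gamVal p (v.erase 0) := by
    rw [gamVal_eq_erase p v 0]
    simp [partVal]
  have h0 : v.erase 0 0 = 0 := Finsupp.erase_same
  refine ⟨v.erase 0, h0, reducedPart_of_nonspecialCount_le_one h0 (by omega), by omega,
    by omega, ?_⟩
  rw [pval_tau p _ h0, pval_tau p _ hu0, WithTop.coe_le_coe]
  have hF : padicValNat p (wt (v.erase 0) + deg (v.erase 0) - 2).factorial ≤
      padicValNat p (wt u + deg u - 2).factorial :=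
    (padicValNat_dvd_iff_le (Nat.factorial_ne_zero _)).1
      (pow_padicValNat_dvd.trans (Nat.factorial_dvd_factorial (by omega)))
  omega

end
end

section
/- Let k ≥ 1, N ≥ 3 and a ≥ 2 be integers, and let Q = (k·2^N + 2a − 3)!!/(k·2^N + 1)!!, i.e. Q = (k·2^N + 3)(k·2^N + 5)···(k·2^N + 2a − 3), the product over odd j with 3 ≤ j ≤ 2a−3 of (k·2^N + j) (so Q = 1 when a = 2). If a is even, then Q ≡ (2a−3)!! (mod 2^{N+1+min(v_2(a), N−1)}); if a is odd, then Q ≡ (2a−3)!! + k·2^N (mod 2^{N+1}). -/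
noncomputable section

/-- double factorial of an odd number: a!! = a(a−2)⋯3·1 -/
def dfac : ℕ → ℕ
  | 0 => 1
  | 1 => 1
  | n + 2 => (n + 2) * dfac n

theorem dfac_two_mul_add_one (n : ℕ) :
    (dfac (2 * n + 1) : ℤ) = ∏ i ∈ Finset.range n, (0 + 2 * (i : ℤ) + 3) := by
  induction n with
  | zero => simp [dfac]
  | succ n ih =>
    rw [Finset.prod_range_succ, ← ih, show 2 * (n + 1) + 1 = (2 * n + 1) + 2 by ring, dfac]
    push_cast
    ring

/-- The factors `x + j` and `x + (2 * a - j)`, where `a = 2 * m + 2`, are paired. -/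
theorem prod_range_two_mul_pairing (x : ℤ) (m : ℕ) :
    ∏ i ∈ Finset.range (2 * m), (x + 2 * (i : ℤ) + 3) =
      ∏ i ∈ Finset.range m, (x ^ 2 + 2 * (2 * m + 2) * x
        + (2 * (i : ℤ) + 3) * (2 * (2 * m + 2) - (2 * i + 3))) := by
  rw [two_mul m, Finset.prod_range_add,
    ← Finset.prod_range_reflect (fun i => x + 2 * ((m + i : ℕ) : ℤ) + 3),
    ← Finset.prod_mul_distrib]
  refine Finset.prod_congr rfl fun i hi => ?_
  obtain ⟨d, rfl⟩ := Nat.exists_eq_add_of_lt (Finset.mem_range.1 hi)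
  rw [show i + d + 1 - 1 - i = d by omega]
  push_cast
  ring

theorem prod_range_two_mul_modEq {x M : ℤ} {m : ℕ} (hsq : M ∣ x ^ 2)
    (hlin : M ∣ 2 * (2 * m + 2) * x) :
    ∏ i ∈ Finset.range (2 * m), (x + 2 * (i : ℤ) + 3) ≡
      ∏ i ∈ Finset.range (2 * m), (0 + 2 * (i : ℤ) + 3) [ZMOD M] := by
  rw [prod_range_two_mul_pairing, prod_range_two_mul_pairing]
  refine Int.ModEq.prod fun i _ => Int.ModEq.add_right _ ?_
  simpa using (Int.modEq_zero_iff_dvd.2 (dvd_add hsq hlin))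

theorem odd_prod_range (n : ℕ) : Odd (∏ i ∈ Finset.range n, (0 + 2 * (i : ℤ) + 3)) :=
  Finset.prod_induction _ Odd (fun _ _ => Odd.mul) odd_one
    fun i _ => ⟨(i : ℤ) + 1, by ring⟩

theorem prod_range_modEq_add_mul {x : ℤ} (hx : Even x) (n : ℕ) :
    ∏ i ∈ Finset.range n, (x + 2 * (i : ℤ) + 3) ≡
      ∏ i ∈ Finset.range n, (0 + 2 * (i : ℤ) + 3) + n * x [ZMOD 2 * x] := by
  induction n with
  | zero => simp
  | succ n ih =>
    rw [Finset.prod_range_succ, Finset.prod_range_succ]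
    refine (ih.mul_right _).trans (Int.modEq_iff_dvd.2 ?_)
    obtain ⟨c, hc⟩ := odd_prod_range n
    obtain ⟨y, hy⟩ := hx
    refine ⟨-c - n * (n + 1) - n * y, ?_⟩
    rw [hc]
    push_cast
    linear_combination (-(n : ℤ) * x) * hy

/-- with Q = (k·2^N+3)(k·2^N+5)⋯(k·2^N+2a−3) = (k·2^N+2a−3)!!/(k·2^N+1)!!,
if a is even then Q ≡ (2a−3)!! mod 2^{N+1+min(v_2(a),N−1)}, and if a is odd then
Q ≡ (2a−3)!! + k·2^N mod 2^{N+1}. -/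
theorem stmt_5 (k N a : ℕ) (hk : 1 ≤ k) (hN : 3 ≤ N) (ha : 2 ≤ a)
    (Q : ℤ) (hQ : Q = ∏ i ∈ Finset.range (a - 2), ((k : ℤ) * 2 ^ N + 2 * i + 3)) :
    (Even a → Q ≡ (dfac (2 * a - 3) : ℤ) [ZMOD 2 ^ (N + 1 + min (padicValNat 2 a) (N - 1))])
    ∧ (Odd a → Q ≡ (dfac (2 * a - 3) : ℤ) + (k : ℤ) * 2 ^ N [ZMOD 2 ^ (N + 1)]) := by
  obtain ⟨n, rfl⟩ := Nat.exists_eq_add_of_le' ha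
  subst hQ
  rw [show 2 * (n + 2) - 3 = 2 * n + 1 by omega, Nat.add_sub_cancel, dfac_two_mul_add_one]
  constructor
  · intro h
    obtain ⟨m, rfl⟩ : ∃ m, n = 2 * m := even_iff_exists_two_mul.1 (by simpa [parity_simps] using h)
    apply prod_range_two_mul_modEq
    · rw [mul_pow, ← pow_mul]
      exact (pow_dvd_pow 2 (by omega)).mul_left _
    · have h2 : (2 : ℤ) ^ padicValNat 2 (2 * m + 2) ∣ 2 * m + 2 := by
        exact_mod_cast pow_padicValNat_dvd (p := 2) (n := 2 * m + 2)
      refine (pow_dvd_pow 2 (show _ ≤ N + 1 + padicValNat 2 (2 * m + 2) by omega)).trans ?_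
      obtain ⟨c, hc⟩ := h2
      exact ⟨c * k, by rw [hc]; ring⟩
  · intro h
    have hn : Odd n := by simpa [parity_simps] using h
    obtain ⟨c, hc⟩ := hn
    have hx : Even ((k : ℤ) * 2 ^ N) :=
      ((even_two.pow_of_ne_zero (by omega)).mul_left _)
    have hdvd : (2 : ℤ) ^ (N + 1) ∣ 2 * (k * 2 ^ N) := ⟨k, by ring⟩
    refine ((prod_range_modEq_add_mul hx n).of_dvd hdvd).trans (Int.ModEq.add_left _ ?_)
    refine Int.modEq_iff_dvd.2 ⟨-(c * k), ?_⟩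
    rw [hc]
    push_cast
    ring

end
end

section
/- Let k ≥ 1, N ≥ 3 and a ≥ 2 be integers. If a is even, then (k·2^N + 2a − 3)!! ≡ (2a−3)!! (mod 2^{N+1}); if a is odd, then (k·2^N + 2a − 3)!! ≡ (2a−3)!! + k·2^N (mod 2^{N+1}). -/
noncomputable section

theorem dfac_odd_add_two (n : ℕ) :
    (dfac (2 * (n + 1) + 1) : ℤ) = (2 * n + 3) * dfac (2 * n + 1) := by
  rw [show 2 * (n + 1) + 1 = (2 * n + 1) + 2 by ring, dfac]
  push_cast
  ring

theorem odd_dfac_odd (n : ℕ) : Odd (dfac (2 * n + 1) : ℤ) := by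
  induction n with
  | zero => simp [dfac]
  | succ n ih =>
    rw [dfac_odd_add_two]
    exact Odd.mul ⟨n + 1, by ring⟩ ih

theorem dfac_four_mul_succ_add_one (n : ℕ) :
    (dfac (4 * (n + 1) + 1) : ℤ) = (4 * n + 5) * (4 * n + 3) * dfac (4 * n + 1) := by
  rw [show 4 * (n + 1) + 1 = (4 * n + 1) + 2 + 2 by ring, dfac, dfac]
  push_cast
  ring

theorem dfac_four_mul_add_modEq (s i : ℕ) :
    (dfac (4 * (s + i) + 1) : ℤ) ≡ dfac (4 * s + 1) * dfac (4 * i + 1) [ZMOD 16 * s] := by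
  induction i with
  | zero => simp [dfac, Int.ModEq.refl]
  | succ i ih =>
    rw [← add_assoc, dfac_four_mul_succ_add_one, dfac_four_mul_succ_add_one, mul_left_comm]
    refine Int.ModEq.mul (Int.modEq_iff_dvd.2 ⟨-(2 * i + s + 2), ?_⟩) ih
    push_cast
    ring

theorem dfac_four_mul_two_pow_modEq (m : ℕ) :
    (dfac (4 * 2 ^ (m + 1) + 1) : ℤ) ≡ 1 [ZMOD 8 * 2 ^ (m + 1)] := by
  induction m with
  | zero => norm_num [dfac, Int.ModEq]
  | succ m ih =>
    have h := dfac_four_mul_add_modEq (2 ^ (m + 1)) (2 ^ (m + 1))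
    rw [show 2 ^ (m + 1) + 2 ^ (m + 1) = 2 ^ (m + 1 + 1) by ring] at h
    push_cast at h
    rw [show (8 : ℤ) * 2 ^ (m + 1 + 1) = 16 * 2 ^ (m + 1) by ring]
    refine h.trans ?_
    obtain ⟨t, ht⟩ := Int.modEq_iff_dvd.1 ih
    refine Int.modEq_iff_dvd.2 ⟨t - 4 * 2 ^ (m + 1) * t ^ 2, ?_⟩
    rw [show (dfac (4 * 2 ^ (m + 1) + 1) : ℤ) = 1 - 8 * 2 ^ (m + 1) * t by linarith]
    ring

theorem dfac_four_mul_mul_two_pow_modEq (k m : ℕ) :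
    (dfac (4 * (k * 2 ^ (m + 1)) + 1) : ℤ) ≡ 1 [ZMOD 8 * 2 ^ (m + 1)] := by
  induction k with
  | zero => simp [dfac, Int.ModEq.refl]
  | succ k ih =>
    have h := dfac_four_mul_add_modEq (k * 2 ^ (m + 1)) (2 ^ (m + 1))
    rw [← add_one_mul] at h
    have hd : (8 * 2 ^ (m + 1) : ℤ) ∣ 16 * (k * 2 ^ (m + 1) : ℕ) :=
      ⟨2 * k, by push_cast; ring⟩
    simpa using (h.of_dvd hd).trans (ih.mul (dfac_four_mul_two_pow_modEq m))

theorem dfac_mul_two_pow_add_modEq (k m b : ℕ) :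
    (dfac (k * 2 ^ (m + 3) + (2 * b + 1)) : ℤ) ≡
      dfac (2 * b + 1) + b * (k * 2 ^ (m + 3)) [ZMOD 2 ^ (m + 4)] := by
  induction b with
  | zero =>
    have h := dfac_four_mul_mul_two_pow_modEq k m
    rw [show 4 * (k * 2 ^ (m + 1)) = k * 2 ^ (m + 3) by ring,
      show (8 : ℤ) * 2 ^ (m + 1) = 2 ^ (m + 4) by ring] at h
    simpa [dfac] using h
  | succ b ih =>
    obtain ⟨d, hd⟩ := odd_dfac_odd b
    rw [dfac_odd_add_two,
      show k * 2 ^ (m + 3) + (2 * (b + 1) + 1) = k * 2 ^ (m + 3) + (2 * b + 1) + 2 by ring, dfac]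
    push_cast
    refine (ih.mul_left _).trans (Int.modEq_iff_dvd.2
      ⟨-(d * k + b * k * (b + 1) + b * k ^ 2 * 2 ^ (m + 2)), ?_⟩)
    rw [hd]
    ring

/-- for k ≥ 1, N ≥ 3, a ≥ 2:
(k·2^N + 2a − 3)!! ≡ (2a−3)!! (mod 2^{N+1}) if a is even, and
(k·2^N + 2a − 3)!! ≡ (2a−3)!! + k·2^N (mod 2^{N+1}) if a is odd. -/
theorem stmt_6 (k N a : ℕ) (hk : 1 ≤ k) (hN : 3 ≤ N) (ha : 2 ≤ a) :
    (Even a → (dfac (k * 2 ^ N + 2 * a - 3) : ℤ) ≡ (dfac (2 * a - 3) : ℤ) [ZMOD 2 ^ (N + 1)])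
    ∧ (Odd a → (dfac (k * 2 ^ N + 2 * a - 3) : ℤ)
        ≡ (dfac (2 * a - 3) : ℤ) + (k : ℤ) * 2 ^ N [ZMOD 2 ^ (N + 1)]) := by
  obtain ⟨m, rfl⟩ := Nat.exists_eq_add_of_le' hN
  obtain ⟨b, rfl⟩ := Nat.exists_eq_add_of_le' ha
  have h := dfac_mul_two_pow_add_modEq k m b
  rw [show k * 2 ^ (m + 3) + 2 * (b + 2) - 3 = k * 2 ^ (m + 3) + (2 * b + 1) by omega,
    show 2 * (b + 2) - 3 = 2 * b + 1 by omega]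
  constructor
  · intro he
    obtain ⟨c, rfl⟩ : Even b := by simpa [Nat.even_add] using he
    refine h.trans (Int.modEq_iff_dvd.2 ⟨-(c * k), ?_⟩)
    push_cast
    ring
  · intro ho
    obtain ⟨c, rfl⟩ : Odd b := by simpa [Nat.odd_add] using ho
    refine h.trans (Int.modEq_iff_dvd.2 ⟨-(c * k), ?_⟩)
    push_cast
    ring

end
end

section
/- Let N ≥ 3 be an integer and k ≥ 1 an odd integer. If N = 3, then (k·2^N − 3)!! ≡ −1 + (−1)^{(k−1)/2}·2^{N+1} (mod 2^{N+3}); if N ≥ 4, then (k·2^N − 3)!! ≡ −1 + (−1)^{(k+1)/2}·2^{N+1} (mod 2^{N+3}). In particular, in both cases (k·2^N − 3)!! ≡ −1 + 2^{N+1} (mod 2^{N+2}). -/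
noncomputable section

open Polynomial in
/-- The product of the `2 ^ n` consecutive odd numbers `X + 1, X + 3, …, X + 2 ^ (n + 1) - 1`. -/
def oddBlock : ℕ → ℤ[X]
  | 0 => X + 1
  | n + 1 => oddBlock n * (oddBlock n).comp (X + C (2 ^ (n + 1)))

lemma oddBlock_eval_succ (n : ℕ) (x : ℤ) :
    (oddBlock (n + 1)).eval x =
      (oddBlock n).eval x * (oddBlock n).eval (x + 2 ^ (n + 1)) := by
  simp [oddBlock]

lemma oddBlock_derivative_eval_succ (n : ℕ) (x : ℤ) :
    (oddBlock (n + 1)).derivative.eval x =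
      (oddBlock n).derivative.eval x * (oddBlock n).eval (x + 2 ^ (n + 1)) +
        (oddBlock n).eval x * (oddBlock n).derivative.eval (x + 2 ^ (n + 1)) := by
  simp only [oddBlock, Polynomial.derivative_mul, Polynomial.derivative_comp,
    Polynomial.derivative_add, Polynomial.derivative_X, Polynomial.derivative_C]
  simp

lemma dfac_two_mul_succ_sub_one (m : ℕ) :
    dfac (2 * (m + 1) - 1) = (2 * m + 1) * dfac (2 * m - 1) := by
  cases m with
  | zero => rfl
  | succ m => rfl

lemma dfac_add_block (n m : ℕ) :
    (dfac (2 * (m + 2 ^ n) - 1) : ℤ) =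
      dfac (2 * m - 1) * (oddBlock n).eval (2 * (m : ℤ)) := by
  induction n generalizing m with
  | zero =>
    rw [pow_zero, dfac_two_mul_succ_sub_one]
    simp [oddBlock, mul_comm]
  | succ n ih =>
    rw [show m + 2 ^ (n + 1) = m + 2 ^ n + 2 ^ n by ring, ih, ih, oddBlock_eval_succ]
    push_cast
    rw [show 2 * ((m : ℤ) + 2 ^ n) = 2 * m + 2 ^ (n + 1) by ring]
    ring

lemma sixteen_dvd_oddBlock_derivative (n : ℕ) (t : ℤ) :
    16 ∣ (oddBlock (n + 2)).derivative.eval (8 * t) := by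
  induction n generalizing t with
  | zero =>
    refine ⟨128 * t ^ 3 + 192 * t ^ 2 + 86 * t + 11, ?_⟩
    simp only [oddBlock_derivative_eval_succ, oddBlock_eval_succ]
    simp [oddBlock]
    ring
  | succ n ih =>
    rw [oddBlock_derivative_eval_succ,
      show 8 * t + 2 ^ (n + 2 + 1) = 8 * (t + 2 ^ n) by ring]
    exact dvd_add ((ih _).mul_right _) ((ih _).mul_left _)

lemma oddBlock_eval_mul_modEq (n : ℕ) (t : ℤ) :
    (oddBlock (n + 2)).eval (2 ^ (n + 3) * t) ≡ (oddBlock (n + 2)).eval 0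
      [ZMOD 2 ^ (n + 6)] := by
  obtain ⟨c, hc⟩ := (oddBlock (n + 2)).binomExpansion 0 (2 ^ (n + 3) * t)
  obtain ⟨d, hd⟩ := sixteen_dvd_oddBlock_derivative n 0
  rw [mul_zero] at hd
  rw [zero_add, hd] at hc
  rw [hc]
  refine (Int.modEq_iff_dvd.2 ⟨-(2 * d * t + c * t ^ 2 * 2 ^ n), ?_⟩)
  ring

lemma oddBlock_eval_two_pow_modEq (n : ℕ) :
    (oddBlock (n + 3)).eval (2 ^ (n + 4)) ≡ (oddBlock (n + 3)).eval 0
      [ZMOD 2 ^ (n + 8)] := by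
  obtain ⟨c, hc⟩ := (oddBlock (n + 3)).binomExpansion 0 (2 ^ (n + 4))
  obtain ⟨d, hd⟩ := sixteen_dvd_oddBlock_derivative (n + 1) 0
  rw [mul_zero] at hd
  rw [zero_add, hd] at hc
  rw [hc]
  refine (Int.modEq_iff_dvd.2 ⟨-(d + c * 2 ^ n), ?_⟩)
  ring

lemma oddBlock_eval_zero_modEq (n : ℕ) :
    (oddBlock (n + 3)).eval 0 ≡ 1 + 2 ^ (n + 4) [ZMOD 2 ^ (n + 7)] := by
  induction n with
  | zero =>
    simp only [oddBlock_eval_succ]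
    simp [oddBlock]
    decide
  | succ n ih =>
    rw [oddBlock_eval_succ, zero_add]
    refine ((oddBlock_eval_two_pow_modEq n).mul_left _).trans ?_
    obtain ⟨u, hu⟩ := Int.modEq_iff_dvd.1 ih.symm
    rw [eq_add_of_sub_eq' hu]
    refine Int.modEq_iff_dvd.2 ⟨-(2 ^ n + u * (1 + 2 ^ (n + 4)) + u ^ 2 * 2 ^ (n + 6)), ?_⟩
    ring

lemma dfac_mul_block_modEq (n k : ℕ) :
    (dfac (2 * (k * 2 ^ (n + 2)) - 1) : ℤ) ≡ (oddBlock (n + 2)).eval 0 ^ k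
      [ZMOD 2 ^ (n + 6)] := by
  induction k with
  | zero => simp [dfac]
  | succ k ih =>
    rw [add_one_mul, dfac_add_block, pow_succ _ k]
    refine ih.mul ?_
    have := oddBlock_eval_mul_modEq n k
    rwa [show (2 : ℤ) ^ (n + 3) * k = 2 * ((k * 2 ^ (n + 2) : ℕ) : ℤ) by push_cast; ring] at this

lemma one_add_two_pow_pow_modEq (n k : ℕ) (c : ℤ) :
    (1 + c * 2 ^ (n + 3)) ^ k ≡ 1 + k * c * 2 ^ (n + 3) [ZMOD 2 ^ (n + 6)] := by
  induction k with
  | zero => simp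
  | succ k ih =>
    rw [pow_succ _ k]
    refine (ih.mul_right _).trans (Int.modEq_iff_dvd.2 ⟨-(k * c ^ 2 * 2 ^ n), ?_⟩)
    push_cast
    ring

lemma dfac_sub_three_modEq (n k : ℕ) (hk : 1 ≤ k) (c : ℤ)
    (hc : (oddBlock (n + 2)).eval 0 ≡ 1 + c * 2 ^ (n + 3) [ZMOD 2 ^ (n + 6)]) :
    (dfac (k * 2 ^ (n + 3) - 3) : ℤ) ≡ -1 - (c + 1) * k * 2 ^ (n + 3) [ZMOD 2 ^ (n + 6)] := by
  have h := (dfac_mul_block_modEq n k).trans ((hc.pow k).trans (one_add_two_pow_pow_modEq n k c))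
  have hpos : 1 ≤ k * 2 ^ (n + 2) := Nat.one_le_iff_ne_zero.2 (by positivity)
  obtain ⟨m, hm⟩ := Nat.exists_eq_add_of_le' hpos
  have hm' : (2 * m + 1 : ℤ) = k * 2 ^ (n + 3) - 1 := by
    have : (k : ℤ) * 2 ^ (n + 2) = m + 1 := by exact_mod_cast hm
    rw [pow_succ _ (n + 2)]
    linarith
  rw [show k * 2 ^ (n + 3) - 3 = 2 * m - 1 by
    rw [pow_succ _ (n + 2), ← mul_assoc]
    omega]
  rw [hm, dfac_two_mul_succ_sub_one] at h
  push_cast at h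
  rw [hm'] at h
  obtain ⟨u, hu⟩ := Int.modEq_iff_dvd.1 h
  refine Int.modEq_iff_dvd.2
    ⟨-u * (1 + k * 2 ^ (n + 3)) + 2 ^ n * k ^ 2 * (c - dfac (2 * m - 1)), ?_⟩
  linear_combination (-(1 + k * 2 ^ (n + 3) : ℤ)) * hu

/-- for N ≥ 3 and odd k ≥ 1:
(k·2^N − 3)!! ≡ −1 + (−1)^{(k−1)/2}·2^{N+1} (mod 2^{N+3}) when N = 3,
(k·2^N − 3)!! ≡ −1 + (−1)^{(k+1)/2}·2^{N+1} (mod 2^{N+3}) when N ≥ 4,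
and in both cases (k·2^N − 3)!! ≡ −1 + 2^{N+1} (mod 2^{N+2}). -/
theorem stmt_7 (k N : ℕ) (hk : 1 ≤ k) (hkodd : Odd k) (hN : 3 ≤ N) :
    (N = 3 → (dfac (k * 2 ^ N - 3) : ℤ)
        ≡ -1 + (-1 : ℤ) ^ ((k - 1) / 2) * 2 ^ (N + 1) [ZMOD 2 ^ (N + 3)])
    ∧ (4 ≤ N → (dfac (k * 2 ^ N - 3) : ℤ)
        ≡ -1 + (-1 : ℤ) ^ ((k + 1) / 2) * 2 ^ (N + 1) [ZMOD 2 ^ (N + 3)])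
    ∧ ((dfac (k * 2 ^ N - 3) : ℤ) ≡ -1 + 2 ^ (N + 1) [ZMOD 2 ^ (N + 2)]) := by
  have reduce (s : ℤ) (hs : Odd s) (h : (dfac (k * 2 ^ N - 3) : ℤ) ≡ -1 + s * 2 ^ (N + 1)
      [ZMOD 2 ^ (N + 3)]) :
      (dfac (k * 2 ^ N - 3) : ℤ) ≡ -1 + 2 ^ (N + 1) [ZMOD 2 ^ (N + 2)] := by
    obtain ⟨r, rfl⟩ := hs
    refine (h.of_dvd (pow_dvd_pow 2 (by omega))).trans (Int.modEq_iff_dvd.2 ⟨-r, ?_⟩)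
    ring
  have odd_sign (j : ℕ) : Odd ((-1 : ℤ) ^ j) := (by decide : Odd (-1 : ℤ)).pow
  have sign : ∃ q : ℤ, (k : ℤ) = 4 * q + (-1) ^ ((k - 1) / 2) ∧
      (-1 : ℤ) ^ ((k + 1) / 2) = -(-1) ^ ((k - 1) / 2) := by
    obtain ⟨j, rfl⟩ := hkodd
    rw [show (2 * j + 1 - 1) / 2 = j by omega, show (2 * j + 1 + 1) / 2 = j + 1 by omega]
    rcases Nat.even_or_odd' j with ⟨i, rfl | rfl⟩
    · exact ⟨i, by simp; ring, by ring⟩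
    · exact ⟨i + 1, by simp [pow_succ]; ring, by ring⟩
  obtain ⟨q, hq, hsign⟩ := sign
  obtain rfl | hN4 := hN.eq_or_lt
  · have hbase : (oddBlock (0 + 2)).eval 0 ≡ 1 + 5 * 2 ^ (0 + 3) [ZMOD 2 ^ (0 + 6)] := by
      simp only [oddBlock_eval_succ]
      simp [oddBlock]
      decide
    have h : (dfac (k * 2 ^ 3 - 3) : ℤ) ≡ -1 + (-1 : ℤ) ^ ((k - 1) / 2) * 2 ^ (3 + 1)
        [ZMOD 2 ^ (3 + 3)] := by
      refine (dfac_sub_three_modEq 0 k hk 5 hbase).trans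
        (Int.modEq_iff_dvd.2 ⟨(-1) ^ ((k - 1) / 2) + 3 * q, ?_⟩)
      linear_combination 48 * hq
    exact ⟨fun _ ↦ h, fun h4 ↦ by omega, reduce _ (odd_sign _) h⟩
  · obtain ⟨n, rfl⟩ := Nat.exists_eq_add_of_le' (Nat.succ_le_of_lt hN4)
    have h : (dfac (k * 2 ^ (n + 4) - 3) : ℤ) ≡
        -1 + (-1 : ℤ) ^ ((k + 1) / 2) * 2 ^ (n + 4 + 1) [ZMOD 2 ^ (n + 4 + 3)] := by
      refine (dfac_sub_three_modEq (n + 1) k hk 1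
        (by simpa using oddBlock_eval_zero_modEq n)).trans (Int.modEq_iff_dvd.2 ⟨q, ?_⟩)
      rw [hsign]
      linear_combination 2 ^ (n + 5) * hq
    exact ⟨fun h3 ↦ by omega, fun _ ↦ h, reduce _ (odd_sign _) h⟩

end
end

section
/- Let a ≥ 0 and i ≥ 1 be integers, and for 1 ≤ j ≤ 2i let f_a(i,j) = ((a+1)(a+2)···(a+2i))/(a+j), which is a positive integer. Then v_2(Σ_{j=1}^{2i} f_a(i,j)) ≥ i − 1 if 1 ≤ i ≤ 3, and v_2(Σ_{j=1}^{2i} f_a(i,j)) ≥ i if i ≥ 4. -/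
noncomputable section

/-- f_a(i,j) = (a+1)(a+2)⋯(a+2i)/(a+j) -/
def f (a i j : ℕ) : ℚ :=
  (∏ t ∈ Finset.Icc 1 (2 * i), ((a : ℚ) + t)) / ((a : ℚ) + j)

/-- The elementary symmetric polynomial of degree `n - 1` in `a + 1, …, a + n`. -/
def sumCoproducts (a : ℕ) : ℕ → ℕ
  | 0 => 0
  | n + 1 => sumCoproducts a n * (a + n + 1) + (a + 1).ascFactorial n

theorem prod_Icc_eq_ascFactorial (a n : ℕ) :
    ∏ t ∈ Finset.Icc 1 n, ((a : ℚ) + t) = ((a + 1).ascFactorial n : ℕ) := by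
  induction n with
  | zero => simp
  | succ n ih =>
    rw [Finset.prod_Icc_succ_top (by omega), ih, Nat.ascFactorial_succ]
    push_cast
    ring

theorem sum_prod_div_eq_sumCoproducts (a n : ℕ) :
    ∑ j ∈ Finset.Icc 1 n, (∏ t ∈ Finset.Icc 1 n, ((a : ℚ) + t)) / ((a : ℚ) + j) =
      (sumCoproducts a n : ℕ) := by
  induction n with
  | zero => simp [sumCoproducts]
  | succ n ih =>
    have hne : (a : ℚ) + ((n + 1 : ℕ) : ℚ) ≠ 0 := by positivity
    rw [Finset.sum_Icc_succ_top (by omega), Finset.prod_Icc_succ_top (by omega),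
      mul_div_cancel_right₀ _ hne, prod_Icc_eq_ascFactorial, sumCoproducts]
    rw [prod_Icc_eq_ascFactorial] at ih
    push_cast
    rw [← ih, Finset.sum_mul]
    congr 1
    refine Finset.sum_congr rfl fun j _ => ?_
    ring

theorem ascFactorial_two_mul_succ (a i : ℕ) :
    (a + 1).ascFactorial (2 * (i + 1)) =
      (a + 1).ascFactorial (2 * i) * ((a + 2 * i + 1) * (a + 2 * i + 1 + 1)) := by
  rw [show 2 * (i + 1) = 2 * i + 1 + 1 by ring, Nat.ascFactorial_succ, Nat.ascFactorial_succ]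
  ring

theorem sumCoproducts_two_mul_succ (a i : ℕ) :
    sumCoproducts a (2 * (i + 1)) =
      sumCoproducts a (2 * i) * ((a + 2 * i + 1) * (a + 2 * i + 1 + 1)) +
        (a + 1).ascFactorial (2 * i) * (2 * (a + 2 * i + 1) + 1) := by
  rw [show 2 * (i + 1) = 2 * i + 1 + 1 by ring, sumCoproducts, sumCoproducts,
    Nat.ascFactorial_succ]
  ring

theorem two_pow_dvd_ascFactorial (a i : ℕ) : 2 ^ i ∣ (a + 1).ascFactorial (2 * i) := by
  induction i with
  | zero => simp
  | succ i ih =>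
    rw [ascFactorial_two_mul_succ, pow_succ]
    exact mul_dvd_mul ih (Nat.even_mul_succ_self _).two_dvd

theorem two_pow_succ_dvd_ascFactorial (a i : ℕ) (hi : 2 ≤ i) :
    2 ^ (i + 1) ∣ (a + 1).ascFactorial (2 * i) := by
  induction i, hi using Nat.le_induction with
  | base =>
    exact (show 2 ^ (2 + 1) ∣ Nat.factorial (2 * 2) by decide).trans
      (Nat.factorial_dvd_ascFactorial _ _)
  | succ i _ ih =>
    rw [ascFactorial_two_mul_succ, pow_succ]
    exact mul_dvd_mul ih (Nat.even_mul_succ_self _).two_dvd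

theorem two_pow_dvd_sumCoproducts_succ (a i : ℕ) :
    2 ^ i ∣ sumCoproducts a (2 * (i + 1)) := by
  induction i with
  | zero => simp
  | succ i ih =>
    rw [sumCoproducts_two_mul_succ]
    refine dvd_add ?_ ((two_pow_dvd_ascFactorial a (i + 1)).mul_right _)
    rw [pow_succ]
    exact mul_dvd_mul ih (Nat.even_mul_succ_self _).two_dvd

theorem two_pow_dvd_sumCoproducts (a i : ℕ) (hi : 4 ≤ i) :
    2 ^ i ∣ sumCoproducts a (2 * i) := by
  induction i, hi using Nat.le_induction with
  | base =>
    rw [show 2 ^ 4 = 16 by norm_num, ← ZMod.natCast_eq_zero_iff]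
    simp only [sumCoproducts, Nat.ascFactorial]
    push_cast
    generalize (a : ZMod 16) = x
    revert x
    decide
  | succ i hi ih =>
    rw [sumCoproducts_two_mul_succ]
    refine dvd_add ?_ ((two_pow_succ_dvd_ascFactorial a i (by omega)).mul_right _)
    rw [pow_succ]
    exact mul_dvd_mul ih (Nat.even_mul_succ_self _).two_dvd

theorem le_pval_natCast {p k n : ℕ} [Fact p.Prime] (h : p ^ k ∣ n) :
    ((k : ℤ) : WithTop ℤ) ≤ pval p (n : ℚ) := by
  unfold pval
  split_ifs with hn
  · exact le_top
  · rw [padicValRat.of_nat]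
    exact_mod_cast (padicValNat_dvd_iff_le (by exact_mod_cast hn)).mp h

/-- v_2(Σ_{j=1}^{2i} f_a(i,j)) ≥ i−1 for 1 ≤ i ≤ 3 and ≥ i for i ≥ 4. -/
theorem stmt_8 (a i : ℕ) (hi : 1 ≤ i) :
    (i ≤ 3 → (((i : ℤ) - 1 : ℤ) : WithTop ℤ) ≤ pval 2 (∑ j ∈ Finset.Icc 1 (2 * i), f a i j))
    ∧ (4 ≤ i → (((i : ℤ) : ℤ) : WithTop ℤ) ≤ pval 2 (∑ j ∈ Finset.Icc 1 (2 * i), f a i j)) := by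
  have hS : ∑ j ∈ Finset.Icc 1 (2 * i), f a i j = (sumCoproducts a (2 * i) : ℕ) :=
    sum_prod_div_eq_sumCoproducts a (2 * i)
  rw [hS]
  refine ⟨fun _ => ?_, fun h => le_pval_natCast (two_pow_dvd_sumCoproducts a i h)⟩
  obtain ⟨k, rfl⟩ := Nat.exists_eq_add_of_le' hi
  simpa using le_pval_natCast (two_pow_dvd_sumCoproducts_succ a k)

end
end

section
/- Let l be a positive integer with v_2(l) = N, let q, r, a be nonnegative integers and e ≥ 1 an integer. (a) If a ≥ 2e, then v_2( (2(l+q+2r)+a)!/(2^{l+q+2r}·(l+q)!·r!) − (2(q+2r)+a)!/(2^{q+2r}·q!·r!) ) ≥ N + e. (b) If a ≥ 2(e+1), then v_2( (2(l+q+2r)+a)!/(2^{l+q+2r+e}·(l+q)!·r!) − (2(q+2r)+a)!/(2^{q+2r+e}·q!·r!) ) ≥ N + 1. -/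
noncomputable section

theorem dvd_mul_choose_add_sub_choose (l x m K : ℕ) (hK : ∀ j, 1 ≤ j → j ≤ m → j ∣ K) :
    (l : ℤ) ∣ (K * (l + x).choose m : ℤ) - K * x.choose m := by
  rw [Nat.add_choose_eq, Finset.Nat.sum_antidiagonal_eq_sum_range_succ_mk,
    Finset.sum_range_succ']
  simp only [Nat.choose_zero_right, Nat.sub_zero, one_mul]
  push_cast
  rw [mul_add, add_sub_cancel_right, Finset.mul_sum]
  refine Finset.dvd_sum fun j hj => ?_
  rw [Finset.mem_range] at hj
  obtain ⟨k, rfl⟩ := hK (j + 1) (by omega) (by omega)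
  have h : (l.choose (j + 1) * (j + 1) : ℤ) = l * (l - 1).choose j := by
    rcases l with _ | l
    · simp
    · exact_mod_cast (Nat.add_one_mul_choose_eq l j).symm
  refine ⟨k * (l - 1).choose j * x.choose (m - (j + 1)), ?_⟩
  push_cast
  linear_combination (k * x.choose (m - (j + 1)) : ℤ) * h

theorem dvd_ascFactorial_of_le {r n j : ℕ} (hr : r ≤ n) (hj : 1 ≤ j) (hjn : j ≤ r + n) :
    j ∣ (r + 1).ascFactorial n := by
  rcases le_or_gt j r with h | h
  · exact (Nat.dvd_factorial hj (h.trans hr)).trans (Nat.factorial_dvd_ascFactorial _ _)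
  · rw [Nat.ascFactorial_eq_prod_range]
    have : j = r + 1 + (j - (r + 1)) := by omega
    rw [this]
    exact Finset.dvd_prod_of_mem (fun i => r + 1 + i) (Finset.mem_range.2 (by omega))

/-- The product of the `n` consecutive odd numbers starting at `2 * x + 1`. -/
def oddProd (x n : ℕ) : ℤ := ∏ i ∈ Finset.range n, (2 * (x + i : ℤ) + 1)

theorem oddProd_add (x m n : ℕ) : oddProd x (m + n) = oddProd x m * oddProd (x + m) n := by
  simp only [oddProd, Finset.prod_range_add]
  push_cast
  simp only [add_assoc]

theorem odd_oddProd (x n : ℕ) : Odd (oddProd x n) :=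
  Finset.prod_induction _ Odd (fun _ _ => Odd.mul) odd_one fun i _ => ⟨x + i, rfl⟩

theorem oddProd_add_modEq (x d n : ℕ) : oddProd (x + d) n ≡ oddProd x n [ZMOD 2 * d] := by
  refine Int.ModEq.prod fun i _ => Int.modEq_iff_dvd.2 ⟨-1, ?_⟩
  push_cast
  ring

theorem oddProd_two_pow_modEq_one (x k : ℕ) : oddProd x (2 ^ k) ≡ 1 [ZMOD 2 ^ k] := by
  induction k with
  | zero => simp [Int.modEq_one]
  | succ k ih =>
    have hsq : oddProd x (2 ^ (k + 1)) ≡ oddProd x (2 ^ k) * oddProd x (2 ^ k)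
        [ZMOD 2 ^ (k + 1)] := by
      rw [show 2 ^ (k + 1) = 2 ^ k + 2 ^ k by ring, oddProd_add]
      refine Int.ModEq.mul_left _ ?_
      have := oddProd_add_modEq x (2 ^ k) (2 ^ k)
      rwa [Nat.cast_pow, Nat.cast_ofNat, ← pow_succ'] at this
    refine hsq.trans (Int.modEq_iff_dvd.2 ?_)
    obtain ⟨t, ht⟩ := Int.modEq_iff_dvd.1 ih
    obtain ⟨s, hs⟩ := odd_oddProd x (2 ^ k)
    refine ⟨t * (s + 1), ?_⟩
    rw [pow_succ]
    linear_combination (1 + oddProd x (2 ^ k)) * ht + 2 ^ k * t * hs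

theorem oddProd_mul_modEq_one (x k u : ℕ) : oddProd x (2 ^ k * u) ≡ 1 [ZMOD 2 ^ k] := by
  induction u with
  | zero => simp [oddProd]
  | succ u ih =>
    rw [mul_add, mul_one, oddProd_add]
    exact ih.mul (oddProd_two_pow_modEq_one _ k)

theorem factorial_two_mul_add (n c : ℕ) (hc : c < 2) :
    ((2 * n + c).factorial : ℤ) = 2 ^ n * n.factorial * oddProd 0 (n + c) := by
  have h0 : ∀ n : ℕ, ((2 * n).factorial : ℤ) = 2 ^ n * n.factorial * oddProd 0 n := by
    intro n
    induction n with
    | zero => simp [oddProd]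
    | succ n ih =>
      rw [show 2 * (n + 1) = 2 * n + 1 + 1 by ring, Nat.factorial_succ, Nat.factorial_succ,
        Nat.factorial_succ, oddProd_add]
      push_cast
      rw [ih]
      simp only [oddProd, Finset.prod_range_one]
      push_cast
      ring
  interval_cases c
  · exact h0 n
  · rw [Nat.factorial_succ, oddProd_add]
    push_cast
    rw [h0 n]
    simp only [oddProd, Finset.prod_range_one]
    push_cast
    ring

theorem factorial_div_eq (q r a : ℕ) :
    ((2 * (q + 2 * r) + a).factorial : ℚ) / (2 ^ (q + 2 * r) * q.factorial * r.factorial) =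
      ((2 ^ (a / 2) * (((r + 1).ascFactorial (r + a / 2) * (q + (2 * r + a / 2)).choose
        (2 * r + a / 2) : ℤ) * oddProd 0 (2 * r + a / 2 + a % 2 + q)) : ℤ) : ℚ) := by
  have hf := factorial_two_mul_add (q + 2 * r + a / 2) (a % 2) (Nat.mod_lt _ two_pos)
  rw [show 2 * (q + 2 * r + a / 2) + a % 2 = 2 * (q + 2 * r) + a by omega,
    show q + 2 * r + a / 2 + a % 2 = 2 * r + a / 2 + a % 2 + q by omega,
    show q + 2 * r + a / 2 = q + (2 * r + a / 2) by omega] at hf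
  have hc := Nat.add_choose_mul_factorial_mul_factorial q (2 * r + a / 2)
  have hr := Nat.factorial_mul_ascFactorial r (r + a / 2)
  rw [show r + (r + a / 2) = 2 * r + a / 2 by omega] at hr
  have hf' := congrArg (Int.cast : ℤ → ℚ) hf
  rw [← hc, ← hr] at hf'
  rw [div_eq_iff (by positivity)]
  push_cast at hf' ⊢
  rw [hf']
  ring

theorem le_pval_two_pow_mul (t : ℕ) (z : ℤ) : ((t : ℤ) : WithTop ℤ) ≤ pval 2 (2 ^ t * z) := by
  unfold pval
  split_ifs with h
  · exact le_top
  · have hz : (z : ℚ) ≠ 0 := right_ne_zero_of_mul h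
    rw [WithTop.coe_le_coe, padicValRat.mul (by positivity) hz, padicValRat.pow,
      padicValRat.of_int, show (2 : ℚ) = ((2 : ℕ) : ℚ) by norm_num, padicValRat.self one_lt_two]
    simp

theorem exists_factorial_div_sub_eq (l q r a : ℕ) : ∃ z : ℤ,
    ((2 * (l + q + 2 * r) + a).factorial : ℚ)
        / (2 ^ (l + q + 2 * r) * (l + q).factorial * r.factorial)
      - ((2 * (q + 2 * r) + a).factorial : ℚ) / (2 ^ (q + 2 * r) * q.factorial * r.factorial)
      = 2 ^ (a / 2 + padicValNat 2 l) * z := by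
  set N := padicValNat 2 l
  obtain ⟨u, hu⟩ : 2 ^ N ∣ l := pow_padicValNat_dvd
  have hG := dvd_mul_choose_add_sub_choose l (q + (2 * r + a / 2)) (2 * r + a / 2)
    ((r + 1).ascFactorial (r + a / 2)) fun j hj hjm =>
      dvd_ascFactorial_of_le (by omega) hj (by omega)
  have h2l : (2 : ℤ) ^ N ∣ l := by exact_mod_cast Dvd.intro u hu.symm
  have hD : oddProd 0 (2 * r + a / 2 + a % 2 + q + l) ≡ oddProd 0 (2 * r + a / 2 + a % 2 + q)
      [ZMOD 2 ^ N] := by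
    have h := oddProd_mul_modEq_one (0 + (2 * r + a / 2 + a % 2 + q)) N u
    rw [← hu] at h
    rw [oddProd_add]
    simpa using h.mul_left (oddProd 0 (2 * r + a / 2 + a % 2 + q))
  obtain ⟨z, hz⟩ := ((Int.modEq_iff_dvd.2 (h2l.trans hG)).mul hD.symm).dvd
  refine ⟨z, ?_⟩
  rw [factorial_div_eq, factorial_div_eq, ← Int.cast_sub, ← mul_sub, add_assoc l q,
    show 2 * r + a / 2 + a % 2 + (l + q) = 2 * r + a / 2 + a % 2 + q + l by omega, hz]
  push_cast
  ring

/-- with v_2(l) = N and e ≥ 1: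
(a) if a ≥ 2e then
(2(l+q+2r)+a)!/(2^{l+q+2r}(l+q)! r!) ≡ (2(q+2r)+a)!/(2^{q+2r} q! r!) (mod 2^{N+e});
(b) if a ≥ 2(e+1) then
(2(l+q+2r)+a)!/(2^{l+q+2r+e}(l+q)! r!) ≡ (2(q+2r)+a)!/(2^{q+2r+e} q! r!) (mod 2^{N+1}). -/
theorem stmt_11 (l N q r a e : ℕ) (hl : 0 < l) (hN : padicValNat 2 l = N) (he : 1 ≤ e) :
    (2 * e ≤ a →
      (((N : ℤ) + (e : ℤ) : ℤ) : WithTop ℤ) ≤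
        pval 2 ((Nat.factorial (2 * (l + q + 2 * r) + a) : ℚ)
            / ((2 : ℚ) ^ (l + q + 2 * r) * (Nat.factorial (l + q) : ℚ) * (Nat.factorial r : ℚ))
          - (Nat.factorial (2 * (q + 2 * r) + a) : ℚ)
            / ((2 : ℚ) ^ (q + 2 * r) * (Nat.factorial q : ℚ) * (Nat.factorial r : ℚ))))
    ∧ (2 * (e + 1) ≤ a →
      (((N : ℤ) + 1 : ℤ) : WithTop ℤ) ≤
        pval 2 ((Nat.factorial (2 * (l + q + 2 * r) + a) : ℚ)
            / ((2 : ℚ) ^ (l + q + 2 * r + e) * (Nat.factorial (l + q) : ℚ) * (Nat.factorial r : ℚ))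
          - (Nat.factorial (2 * (q + 2 * r) + a) : ℚ)
            / ((2 : ℚ) ^ (q + 2 * r + e) * (Nat.factorial q : ℚ) * (Nat.factorial r : ℚ)))) := by
  obtain ⟨z, hz⟩ := exists_factorial_div_sub_eq l q r a
  rw [hN] at hz
  refine ⟨fun ha => ?_, fun ha => ?_⟩
  · rw [hz]
    obtain ⟨d, hd⟩ := Nat.exists_eq_add_of_le (show e ≤ a / 2 by omega)
    have h := le_pval_two_pow_mul (N + e) (2 ^ d * z)
    convert h using 2
    · norm_cast
    rw [hd]
    push_cast
    ring
  · obtain ⟨d, hd⟩ := Nat.exists_eq_add_of_le (show e + 1 ≤ a / 2 by omega)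
    have h := le_pval_two_pow_mul (N + 1) (2 ^ d * z)
    convert h using 2
    · norm_cast
    have hsplit : ∀ A x y : ℚ, ∀ n : ℕ,
        A / (2 ^ (n + e) * x * y) = A / (2 ^ n * x * y) / 2 ^ e := by
      intro A x y n
      rw [div_div, pow_add]
      ring
    rw [hsplit, hsplit, ← sub_div, hz, hd, div_eq_iff (by positivity)]
    push_cast
    ring

end
end

section
/- Let u be a partition with w(u) = n and d = d(u). Set e = v_2(γ_u) − v_2((2u_1)!) − 2u_3 − v_2(u_3!) and ṅ = n − u_1 − 3u_3. Then: (i) if ṅ = 0, then n + d − 2 = 2(u_1 + 2u_3 + e) − 2; (ii) if ṅ = 7·2^α and u_7 = 2^α for some integer α ≥ 0 (i.e. u_i = 0 for all i ∉ {1,3,7} and u_7 = 2^α), then n + d − 2 = 2(u_1 + 2u_3 + e); (iii) if ṅ = 2, then n + d − 2 = 2(u_1 + 2u_3 + e) + 1; (iv) in all other cases with ṅ > 0, n + d − 2 ≥ 2(u_1 + 2u_3 + e) + 2. -/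
open Finsupp MvPolynomial

noncomputable section

theorem two_adic_factorial_succ_le {m : ℕ} (hm : 0 < m) :
    padicValNat 2 m.factorial + 1 ≤ m ∧
      (padicValNat 2 m.factorial + 1 = m ↔ ∃ α : ℕ, m = 2 ^ α) := by
  induction m using Nat.strong_induction_on with
  | _ m ih =>
    rcases Nat.even_or_odd' m with ⟨k, rfl | rfl⟩
    · have hk : 0 < k := by omega
      obtain ⟨hle, hiff⟩ := ih k (by omega) hk
      rw [padicValNat_factorial_mul]
      refine ⟨by omega, ?_⟩
      have hred : padicValNat 2 k.factorial + k + 1 = 2 * k ↔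
          padicValNat 2 k.factorial + 1 = k := by omega
      rw [hred, hiff]
      constructor
      · rintro ⟨α, rfl⟩
        exact ⟨α + 1, by ring⟩
      · rintro ⟨α, hα⟩
        rcases α with _ | α
        · rw [pow_zero] at hα
          omega
        · rw [pow_succ] at hα
          exact ⟨α, by omega⟩
    · rw [padicValNat_factorial_mul_add k (by norm_num : 1 < 2), padicValNat_factorial_mul]
      rcases Nat.eq_zero_or_pos k with rfl | hk
      · simpa using ⟨0, by norm_num⟩
      · obtain ⟨hle, -⟩ := ih k (by omega) hk
        refine ⟨by omega, fun h => by omega, ?_⟩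
        rintro ⟨α, hα⟩
        rcases α with _ | α
        · rw [pow_zero] at hα
          omega
        · rw [pow_succ] at hα
          omega

theorem two_mul_padicValNat_succ_add_three_le {i : ℕ} (hi : 4 ≤ i) (hi7 : i ≠ 7) :
    2 * padicValNat 2 (i + 1) + 3 ≤ i := by
  obtain ⟨c, hc⟩ := pow_padicValNat_dvd (p := 2) (n := i + 1)
  generalize padicValNat 2 (i + 1) = v at hc ⊢
  by_cases hv : v < 4
  · interval_cases v <;> omega
  · have hpow : 2 * v + 4 ≤ 2 ^ v := by
      clear hc
      induction v, not_lt.mp hv using Nat.le_induction with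
      | base => norm_num
      | succ w hw ih =>
        rw [pow_succ]
        have := ih (by omega)
        omega
    have hcpos : 0 < c := Nat.pos_of_ne_zero (by rintro rfl; omega)
    have := Nat.le_mul_of_pos_right (2 ^ v) hcpos
    omega

/-- The contribution of `m` parts equal to `i` to `w(u) + d(u) - 2 v_2(γ_u)`. -/
def twoAdicExcess (i m : ℕ) : ℤ :=
  (i + 1) * m - 2 * (padicValNat 2 (i + 1) * m + padicValNat 2 m.factorial)

theorem padicValNat_gam_s13 (u : ℕ →₀ ℕ) :
    (padicValNat 2 (gam u) : ℤ) =
      u.sum fun i m => ((padicValNat 2 (i + 1) * m + padicValNat 2 m.factorial : ℕ) : ℤ) := by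
  have hprod : ∀ s : Finset ℕ,
      padicValNat 2 (∏ i ∈ s, (i + 1) ^ u i * (u i).factorial) =
        ∑ i ∈ s, (padicValNat 2 (i + 1) * u i + padicValNat 2 (u i).factorial) := by
    intro s
    induction s using Finset.induction_on with
    | empty => simp
    | insert a s ha ih =>
      rw [Finset.prod_insert ha, Finset.sum_insert ha, padicValNat.mul, ih, padicValNat.mul,
        padicValNat.pow, mul_comm (u a)]
      all_goals positivity
  rw [gam, Finsupp.prod, hprod, Finsupp.sum, Nat.cast_sum]

theorem wt_add_deg_sub_padicValNat_gam (u : ℕ →₀ ℕ) :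
    (wt u : ℤ) + deg u - 2 * padicValNat 2 (gam u) = u.sum twoAdicExcess := by
  rw [padicValNat_gam_s13]
  simp only [wt, deg, Finsupp.sum, twoAdicExcess]
  push_cast
  rw [Finset.mul_sum, ← Finset.sum_add_distrib, ← Finset.sum_sub_distrib]
  exact Finset.sum_congr rfl fun i _ => by ring

theorem twoAdicExcess_one (m : ℕ) :
    twoAdicExcess 1 m = 2 * m - 2 * padicValNat 2 (2 * m).factorial := by
  rw [padicValNat_factorial_mul, twoAdicExcess]
  norm_num
  ring

theorem twoAdicExcess_three (m : ℕ) :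
    twoAdicExcess 3 m = - 2 * padicValNat 2 m.factorial := by
  have h : padicValNat 2 (3 + 1) = 2 := padicValNat.prime_pow (p := 2) 2
  rw [twoAdicExcess, h]
  push_cast
  ring

theorem twoAdicExcess_two (m : ℕ) :
    twoAdicExcess 2 m = 3 * m - 2 * padicValNat 2 m.factorial := by
  have h : padicValNat 2 (2 + 1) = 0 := padicValNat.eq_zero_of_not_dvd (by norm_num)
  rw [twoAdicExcess, h]
  push_cast
  ring

theorem twoAdicExcess_seven (m : ℕ) :
    twoAdicExcess 7 m = 2 * m - 2 * padicValNat 2 m.factorial := by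
  have h : padicValNat 2 (7 + 1) = 3 := padicValNat.prime_pow (p := 2) 3
  rw [twoAdicExcess, h]
  push_cast
  ring

theorem two_le_twoAdicExcess {i m : ℕ} (hi : 2 ≤ i) (hi3 : i ≠ 3) (hm : 0 < m) :
    2 ≤ twoAdicExcess i m ∧
      (twoAdicExcess i m < 4 → (i = 2 ∧ m = 1) ∨ (i = 7 ∧ ∃ α : ℕ, m = 2 ^ α)) := by
  obtain ⟨hle, hiff⟩ := two_adic_factorial_succ_le hm
  by_cases hi2 : i = 2
  · subst hi2
    rw [twoAdicExcess_two]
    exact ⟨by omega, fun h => Or.inl ⟨rfl, by omega⟩⟩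
  by_cases hi7 : i = 7
  · subst hi7
    rw [twoAdicExcess_seven]
    exact ⟨by omega, fun h => Or.inr ⟨rfl, hiff.mp (by omega)⟩⟩
  have hv := two_mul_padicValNat_succ_add_three_le (by omega) hi7
  have h4 : 4 ≤ twoAdicExcess i m := by
    rw [twoAdicExcess]
    generalize padicValNat 2 (i + 1) = v at hv ⊢
    generalize padicValNat 2 m.factorial = t at hle ⊢
    zify at hv hle hm
    nlinarith [mul_nonneg (sub_nonneg.mpr hv) (Int.natCast_nonneg m)]
  exact ⟨by omega, fun h => by omega⟩

/-- with e = v_2(γ_u) − v_2((2u_1)!) − 2u_3 − v_2(u_3!) and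
ṅ = n − u_1 − 3u_3, the quantity n + d − 2 equals 2(u_1+2u_3+e) − 2, 2(u_1+2u_3+e),
2(u_1+2u_3+e) + 1 in cases (i) ṅ=0, (ii) ṅ=7·2^α & u_7=2^α, (iii) ṅ=2
respectively, and is ≥ 2(u_1+2u_3+e) + 2 in all other cases with ṅ > 0. -/
theorem stmt_13 (u : ℕ →₀ ℕ) (hu0 : u 0 = 0) (n : ℕ) (hw : wt u = n) (hpos : 0 < n)
    (e : ℤ)
    (he : e = (padicValNat 2 (gam u) : ℤ) - (padicValNat 2 (Nat.factorial (2 * u 1)) : ℤ)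
        - 2 * (u 3 : ℤ) - (padicValNat 2 (Nat.factorial (u 3)) : ℤ))
    (ndot : ℕ) (hndot : ndot = n - (u 1 + 3 * u 3)) :
    (ndot = 0 →
      (n : ℤ) + (deg u : ℤ) - 2 = 2 * ((u 1 : ℤ) + 2 * (u 3 : ℤ) + e) - 2)
    ∧ ((∃ α : ℕ, ndot = 7 * 2 ^ α ∧ u 7 = 2 ^ α) →
      (n : ℤ) + (deg u : ℤ) - 2 = 2 * ((u 1 : ℤ) + 2 * (u 3 : ℤ) + e))
    ∧ (ndot = 2 →
      (n : ℤ) + (deg u : ℤ) - 2 = 2 * ((u 1 : ℤ) + 2 * (u 3 : ℤ) + e) + 1)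
    ∧ (0 < ndot → ndot ≠ 2 → ¬ (∃ α : ℕ, ndot = 7 * 2 ^ α ∧ u 7 = 2 ^ α) →
      2 * ((u 1 : ℤ) + 2 * (u 3 : ℤ) + e) + 2 ≤ (n : ℤ) + (deg u : ℤ) - 2) := by
  set T : Finset ℕ := (u.support.erase 1).erase 3 with hT
  have hsum : ∀ {M : Type} [AddCommMonoid M] (f : ℕ → ℕ → M), (∀ i, f i 0 = 0) →
      u.sum f = f 1 (u 1) + (f 3 (u 3) + ∑ i ∈ T, f i (u i)) := by
    intro M _ f hf
    have h3 : 3 ∉ T := by simp [hT]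
    have h1 : 1 ∉ insert 3 T := by simp [hT]
    rw [← Finset.sum_insert (f := fun i => f i (u i)) h3,
      ← Finset.sum_insert (f := fun i => f i (u i)) h1]
    refine Finsupp.sum_of_support_subset u (fun i hi => ?_) f fun i _ => hf i
    by_cases hi1 : i = 1
    · simp [hi1]
    by_cases hi3 : i = 3
    · simp [hi3]
    simp [hT, hi1, hi3, Finsupp.mem_support_iff.mp hi]
  have hTspec : ∀ i ∈ T, 2 ≤ i ∧ i ≠ 3 ∧ 0 < u i := by
    intro i hi
    simp only [hT, Finset.mem_erase, Finsupp.mem_support_iff] at hi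
    obtain ⟨hi3, hi1, hui⟩ := hi
    have : i ≠ 0 := by rintro rfl; exact hui hu0
    exact ⟨by omega, hi3, Nat.pos_of_ne_zero hui⟩
  have hweight : ndot = ∑ i ∈ T, i * u i := by
    have h := hsum (fun i m => i * m) fun i => by simp
    rw [← wt, hw] at h
    omega
  have hexcess : (n : ℤ) + deg u - 2 - 2 * (u 1 + 2 * u 3 + e) =
      ∑ i ∈ T, twoAdicExcess i (u i) - 2 := by
    have h := wt_add_deg_sub_padicValNat_gam u
    rw [hsum twoAdicExcess fun i => by simp [twoAdicExcess], twoAdicExcess_one,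
      twoAdicExcess_three, hw] at h
    linarith
  have hT_eq_singleton : ∀ i ∈ T, ndot = i * u i → T = {i} := by
    intro i hi h
    refine Finset.eq_singleton_iff_unique_mem.mpr ⟨hi, fun j hj => ?_⟩
    by_contra hji
    have hpair : i * u i + j * u j ≤ ndot := by
      rw [hweight, ← Finset.sum_pair (f := fun i => i * u i) (Ne.symm hji)]
      exact Finset.sum_le_sum_of_subset
        (Finset.insert_subset hi (Finset.singleton_subset_iff.mpr hj))
    obtain ⟨hj2, -, huj⟩ := hTspec j hj
    have := Nat.mul_pos (by omega : 0 < j) huj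
    omega
  refine ⟨fun h0 => ?_, ?_, fun h2 => ?_, fun hndot0 hndot2 hndot7 => ?_⟩
  · have hTempty : T = ∅ := by
      refine Finset.eq_empty_of_forall_notMem fun i hi => ?_
      have h := Finset.sum_eq_zero_iff.mp (hweight.symm.trans h0) i hi
      obtain ⟨hi2, -, hui⟩ := hTspec i hi
      have := Nat.mul_pos (by omega : 0 < i) hui
      omega
    rw [hTempty, Finset.sum_empty] at hexcess
    linarith
  · rintro ⟨α, hα, hu7⟩
    have h7 : 7 ∈ T := by simp [hT, hu7]
    rw [hT_eq_singleton 7 h7 (by rw [hα, hu7]), Finset.sum_singleton,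
      twoAdicExcess_seven] at hexcess
    have hv := (two_adic_factorial_succ_le (hTspec 7 h7).2.2).2.mpr ⟨α, hu7⟩
    omega
  · have hTne : T.Nonempty := Finset.nonempty_of_sum_ne_zero (by rw [← hweight, h2]; norm_num)
    obtain ⟨i, hi⟩ := hTne
    obtain ⟨hi2, -, hui⟩ := hTspec i hi
    have hle : i * u i ≤ 2 := by
      rw [← h2, hweight]
      exact Finset.single_le_sum (f := fun i => i * u i) (fun _ _ => Nat.zero_le _) hi
    have hui1 : u i = 1 := by nlinarith
    obtain rfl : i = 2 := by
      rw [hui1] at hle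
      omega
    rw [hT_eq_singleton 2 hi (by rw [h2, hui1]), Finset.sum_singleton, twoAdicExcess_two,
      hui1] at hexcess
    norm_num at hexcess
    linarith
  · have hfour : 4 ≤ ∑ i ∈ T, twoAdicExcess i (u i) := by
      have hnonneg : ∀ i ∈ T, 2 ≤ twoAdicExcess i (u i) := fun i hi =>
        (two_le_twoAdicExcess (hTspec i hi).1 (hTspec i hi).2.1 (hTspec i hi).2.2).1
      have hcard : 2 * (T.card : ℤ) ≤ ∑ i ∈ T, twoAdicExcess i (u i) := by
        simpa [mul_comm] using Finset.card_nsmul_le_sum T _ 2 hnonneg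
      by_cases hT2 : 2 ≤ T.card
      · omega
      have hTne : T.Nonempty := Finset.nonempty_of_sum_ne_zero (hweight ▸ hndot0.ne')
      obtain ⟨i, hTi⟩ := Finset.card_eq_one.mp (by have := hTne.card_pos; omega : T.card = 1)
      obtain ⟨hi2, hi3, hui⟩ := hTspec i (by simp [hTi])
      rw [hTi, Finset.sum_singleton] at hweight ⊢
      by_contra hlt
      rcases (two_le_twoAdicExcess hi2 hi3 hui).2 (not_le.mp hlt) with
        ⟨rfl, hu2⟩ | ⟨rfl, α, hu7⟩
      · rw [hu2] at hweight
        omega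
      · exact hndot7 ⟨α, by rw [hweight, hu7], hu7⟩
    linarith

end
end
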